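/- arXiv:1809.07427 — 10 statements merged into one kernel-verified Lean document; each statement's English description precedes it below -/
import Mathlib

section
/- Let X be a set and let α, β be partitions over X (equivalence relations on X ⊕ X). Then the symmetric difference of the induced kernel partitions satisfies #(ᾱ △ β̄) ≤ #(cl(α) △ cl(β)), and dually for the cokernel partitions #(α̲ △ β̲) ≤ #(cl(α) △ cl(β)). (Lemma 4.9 (vii),(viii).) -/
open Cardinal
open scoped symmDiff

namespace PartitionCongruences

variable {X : Type*}

/-- A partition over `X` is a setoid on `X ⊕ X`; `PMon X` is the carrier of the
partition monoid. -/
abbrev PMon (X : Type*) := Setoid (X ⊕ X)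

/-- The set of blocks of a partition. -/
def cl (α : PMon X) : Set (Set (X ⊕ X)) := α.classes

/-- A block of `α` is a transversal if it meets both summands. -/
def IsTransversal (α : PMon X) (B : Set (X ⊕ X)) : Prop :=
  B ∈ α.classes ∧ (∃ x : X, Sum.inl x ∈ B) ∧ (∃ x : X, Sum.inr x ∈ B)

/-- The rank of a partition: the number of its transversals. -/
def rank (α : PMon X) : Cardinal :=
  #{B : Set (X ⊕ X) // IsTransversal α B}

/-- The kernel partition `ᾱ`. -/
def ker (α : PMon X) : Set (Set X) := (Setoid.comap Sum.inl α).classes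

/-- The cokernel partition `α̲`. -/
def coker (α : PMon X) : Set (Set X) := (Setoid.comap Sum.inr α).classes

/-- Left summand to top copy, right summand to middle copy. -/
def dmap (X : Type*) : X ⊕ X → X ⊕ (X ⊕ X) :=
  Sum.elim Sum.inl (fun x => Sum.inr (Sum.inl x))

/-- Left summand to middle copy, right summand to bottom copy. -/
def umap (X : Type*) : X ⊕ X → X ⊕ (X ⊕ X) :=
  Sum.elim (fun x => Sum.inr (Sum.inl x)) (fun x => Sum.inr (Sum.inr x))

/-- Left summand to top copy, right summand to bottom copy. -/
def emap (X : Type*) : X ⊕ X → X ⊕ (X ⊕ X) :=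
  Sum.elim Sum.inl (fun x => Sum.inr (Sum.inr x))

/-- The pushforward of a setoid along a map: the smallest setoid relating `f x` and
`f y` whenever `σ` relates `x` and `y`. -/
def push {A B : Type*} (f : A → B) (σ : Setoid A) : Setoid B :=
  Relation.EqvGen.setoid (fun a b => ∃ x y, σ x y ∧ f x = a ∧ f y = b)

/-- The product of the partition monoid. -/
instance : Mul (PMon X) :=
  ⟨fun α β => Setoid.comap (emap X) (push (dmap X) α ⊔ push (umap X) β)⟩


theorem classes_comap_sdiff_subset {A B : Type*} (f : A → B) (σ τ : Setoid B) :
    (Setoid.comap f σ).classes \ (Setoid.comap f τ).classes ⊆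
      (f ⁻¹' ·) '' (σ.classes \ τ.classes) := by
  rintro _ ⟨⟨a, rfl⟩, hτ⟩
  refine ⟨{b | σ b (f a)}, ⟨σ.mem_classes _, fun h => hτ ⟨a, ?_⟩⟩, rfl⟩
  have h_eq : {b | σ b (f a)} = {b | τ b (f a)} :=
    Setoid.eq_of_mem_classes h (σ.refl (f a)) (τ.mem_classes _) (τ.refl (f a))
  exact congrArg (f ⁻¹' ·) h_eq

theorem mk_symmDiff_classes_comap_le.{u} {A B : Type u} (f : A → B) (σ τ : Setoid B) :
    #↥((Setoid.comap f σ).classes ∆ (Setoid.comap f τ).classes) ≤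
      #↥(σ.classes ∆ τ.classes) := by
  refine (Cardinal.mk_le_mk_of_subset ?_).trans
    (Cardinal.mk_image_le (f := fun s : Set B => f ⁻¹' s))
  rw [Set.symmDiff_def, Set.symmDiff_def, Set.image_union]
  exact Set.union_subset_union (classes_comap_sdiff_subset f σ τ)
    (classes_comap_sdiff_subset f τ σ)

/-- Lemma 4.9 (vii),(viii): `#(ᾱ △ β̄) ≤ #(α △ β)` and `#(α̲ △ β̲) ≤ #(α △ β)`. -/
theorem kernel_symmDiff_le_and_cokernel_symmDiff_le (α β : PMon X) :
    #↥(ker α ∆ ker β) ≤ #↥(cl α ∆ cl β) ∧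
      #↥(coker α ∆ coker β) ≤ #↥(cl α ∆ cl β) := by
  exact ⟨mk_symmDiff_classes_comap_le Sum.inl α β, mk_symmDiff_classes_comap_le Sum.inr α β⟩

end PartitionCongruences
end

section
/- Let X be a set and let α, β be partitions over X (equivalence relations on X ⊕ X). Then #(cl(α) △ cl(β)) ≤ #(ᾱ △ β̄) + #(α̲ △ β̲) + 3·rank(α) + 3·rank(β), as cardinals. (Lemma 4.9 (ix).) -/
open Cardinal
open scoped symmDiff

namespace PartitionCongruences

variable {X : Type*}

theorem preimage_mem_classes_comap {A B : Type*} (f : A → B) (σ : Setoid B) {s : Set B}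
    (hs : s ∈ σ.classes) {a : A} (ha : f a ∈ s) : f ⁻¹' s ∈ (Setoid.comap f σ).classes := by
  obtain ⟨y, rfl⟩ := hs
  refine ⟨a, Set.ext fun x => ?_⟩
  exact ⟨fun hx => σ.trans hx (σ.symm ha), fun hx => σ.trans hx ha⟩

theorem exists_class_of_mem_classes_comap {A B : Type*} (f : A → B) (σ : Setoid B) {t : Set A}
    (ht : t ∈ (Setoid.comap f σ).classes) :
    ∃ s ∈ σ.classes, f ⁻¹' s = t ∧ ∃ a, f a ∈ s := by
  obtain ⟨a, rfl⟩ := ht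
  exact ⟨{y | σ y (f a)}, ⟨f a, rfl⟩, rfl, a, σ.refl (f a)⟩

/-- A block of `σ` inside the range of `f` that is not a block of `τ` has a preimage which either
is not a class of the pullback of `τ`, or comes from a block of `τ` leaving the range of `f`. -/
theorem preimage_notMem_or_exists_class {A B : Type*} (f : A → B) (τ : Setoid B)
    {s : Set B} (hs : s ∉ τ.classes) (hf : s ⊆ Set.range f) :
    f ⁻¹' s ∉ (Setoid.comap f τ).classes ∨
      ∃ t ∈ τ.classes, (∃ a, f a ∈ t) ∧ (∃ b ∈ t, b ∉ Set.range f) ∧ f '' (f ⁻¹' t) = s := by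
  refine or_iff_not_imp_left.2 fun h => ?_
  obtain ⟨t, ht, hts, hne⟩ := exists_class_of_mem_classes_comap f τ (not_not.1 h)
  have himage : f '' (f ⁻¹' t) = s := by rw [hts, Set.image_preimage_eq_of_subset hf]
  refine ⟨t, ht, hne, ?_, himage⟩
  by_contra! hsub
  rw [Set.image_preimage_eq_of_subset hsub] at himage
  exact hs (himage ▸ ht)

theorem cl_diff_subset (α β : PMon X) :
    cl α \ cl β ⊆ {B | IsTransversal α B} ∪
      (Set.image Sum.inl '' (ker α \ ker β) ∪ Set.image Sum.inr '' (coker α \ coker β)) ∪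
      ((fun C => Sum.inl '' (Sum.inl ⁻¹' C)) '' {B | IsTransversal β B} ∪
        (fun C => Sum.inr '' (Sum.inr ⁻¹' C)) '' {B | IsTransversal β B}) := by
  rintro B ⟨hα, hβ⟩
  obtain ⟨b, hb⟩ : B.Nonempty := by
    obtain ⟨y, rfl⟩ := hα
    exact ⟨y, α.refl y⟩
  by_cases hl : ∃ x : X, Sum.inl x ∈ B
  · by_cases hr : ∃ x : X, Sum.inr x ∈ B
    · exact Or.inl (Or.inl ⟨hα, hl, hr⟩)
    have hsub : B ⊆ Set.range (Sum.inl : X → X ⊕ X) := by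
      rintro (x | x) hx
      · exact ⟨x, rfl⟩
      · exact (hr ⟨x, hx⟩).elim
    obtain ⟨x, hx⟩ := hl
    rcases preimage_notMem_or_exists_class Sum.inl β hβ hsub with h | ⟨C, hC, hCl, hCr, hCB⟩
    · exact Or.inl (Or.inr (Or.inl ⟨_, ⟨preimage_mem_classes_comap _ α hα hx, h⟩,
        Set.image_preimage_eq_of_subset hsub⟩))
    · refine Or.inr (Or.inl ⟨C, ⟨hC, hCl, ?_⟩, hCB⟩)
      obtain ⟨y | y, hy, hyr⟩ := hCr
      · exact (hyr ⟨y, rfl⟩).elim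
      · exact ⟨y, hy⟩
  · have hsub : B ⊆ Set.range (Sum.inr : X → X ⊕ X) := by
      rintro (x | x) hx
      · exact (hl ⟨x, hx⟩).elim
      · exact ⟨x, rfl⟩
    obtain ⟨x, rfl⟩ := hsub hb
    rcases preimage_notMem_or_exists_class Sum.inr β hβ hsub with h | ⟨C, hC, hCr, hCl, hCB⟩
    · exact Or.inl (Or.inr (Or.inr ⟨_, ⟨preimage_mem_classes_comap _ α hα hb, h⟩,
        Set.image_preimage_eq_of_subset hsub⟩))
    · refine Or.inr (Or.inr ⟨C, ⟨hC, ?_, hCr⟩, hCB⟩)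
      obtain ⟨y | y, hy, hyr⟩ := hCl
      · exact ⟨y, hy⟩
      · exact (hyr ⟨y, rfl⟩).elim

theorem mk_cl_diff_le (α β : PMon X) :
    #↥(cl α \ cl β) ≤
      rank α + (#↥(ker α \ ker β) + #↥(coker α \ coker β)) + (rank β + rank β) :=
  (mk_le_mk_of_subset (cl_diff_subset α β)).trans <|
    (mk_union_le _ _).trans <| add_le_add
      ((mk_union_le _ _).trans <| add_le_add le_rfl <|
        (mk_union_le _ _).trans <| add_le_add mk_image_le mk_image_le)
      ((mk_union_le _ _).trans <| add_le_add mk_image_le mk_image_le)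

theorem mk_symmDiff_eq_add {A : Type*} (s t : Set A) : #↥(s ∆ t) = #↥(s \ t) + #↥(t \ s) :=
  mk_union_of_disjoint disjoint_sdiff_sdiff

/-- Lemma 4.9 (ix): `#(α △ β) ≤ #(ᾱ △ β̄) + #(α̲ △ β̲) + 3·rank α + 3·rank β`. -/
theorem symmDiff_le_kernel_add_cokernel_add_ranks (α β : PMon X) :
    #↥(cl α ∆ cl β) ≤
      #↥(ker α ∆ ker β) + #↥(coker α ∆ coker β) + 3 * rank α + 3 * rank β := by
  rw [mk_symmDiff_eq_add, mk_symmDiff_eq_add, mk_symmDiff_eq_add]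
  refine (add_le_add (mk_cl_diff_le α β) (mk_cl_diff_le β α)).trans (le_of_eq ?_)
  ring

end PartitionCongruences
end

section
/- Let X be a set, let ξ be a cardinal with ξ = 1 or ξ ≥ ℵ₀, and let α, β be partitions over X (equivalence relations on X ⊕ X) with #(cl(α) △ cl(β)) < ξ. If rank(α) ≥ ξ, then rank(α) = rank(β). (Lemma 4.17.) -/
open Cardinal
open scoped symmDiff

namespace PartitionCongruences

variable {X : Type*}

/-- If each of two sets contains fewer than `ξ` elements outside the other, where `ξ = 1` or `ξ` is
infinite, and one of them has at least `ξ` elements, then they are equinumerous. -/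
theorem mk_eq_of_mk_diff_lt {A : Type*} {S T : Set A} {ξ : Cardinal} (hξ : ξ = 1 ∨ ℵ₀ ≤ ξ)
    (hST : #↥(S \ T) < ξ) (hTS : #↥(T \ S) < ξ) (hS : ξ ≤ #S) : #S = #T := by
  rcases hξ with rfl | hξ
  · rw [Cardinal.lt_one_iff, Cardinal.mk_set_eq_zero_iff, Set.sdiff_eq_empty] at hST hTS
    rw [hST.antisymm hTS]
  have h₁ : #S = #↥(S ∩ T) + #↥(S \ T) := by
    rw [← Cardinal.mk_union_of_disjoint Set.disjoint_sdiff_inter.symm, Set.inter_union_sdiff]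
  have h₂ : #T = #↥(S ∩ T) + #↥(T \ S) := by
    rw [Set.inter_comm, ← Cardinal.mk_union_of_disjoint Set.disjoint_sdiff_inter.symm,
      Set.inter_union_sdiff]
  have h₃ : ξ ≤ #↥(S ∩ T) := by
    by_contra! h
    exact (hS.trans_eq h₁).not_gt (Cardinal.add_lt_of_lt hξ h hST)
  rw [h₁, h₂, Cardinal.add_eq_left (hξ.trans h₃) (hST.le.trans h₃),
    Cardinal.add_eq_left (hξ.trans h₃) (hTS.le.trans h₃)]

/-- Lemma 4.17: if `#(α △ β) < ξ` (with `ξ = 1` or `ξ ≥ ℵ₀`) and `rank α ≥ ξ`,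
then `rank α = rank β`. -/
theorem rank_eq_of_symmDiff_lt (ξ : Cardinal) (hξ : ξ = 1 ∨ ℵ₀ ≤ ξ)
    (α β : PMon X) (hαβ : #↥(cl α ∆ cl β) < ξ) (hrank : ξ ≤ rank α) :
    rank α = rank β := by
  have hdiff (γ δ : PMon X) :
      {B | IsTransversal γ B} \ {B | IsTransversal δ B} ⊆ cl γ ∆ cl δ :=
    fun _ hB => Or.inl ⟨hB.1.1, fun hδ => hB.2 ⟨hδ, hB.1.2⟩⟩
  exact mk_eq_of_mk_diff_lt (S := {B | IsTransversal α B}) (T := {B | IsTransversal β B}) hξ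
    ((Cardinal.mk_le_mk_of_subset (hdiff α β)).trans_lt hαβ)
    ((Cardinal.mk_le_mk_of_subset (symmDiff_comm (cl α) (cl β) ▸ hdiff β α)).trans_lt hαβ) hrank

end PartitionCongruences
end

section
/- Let α and β be setoids on a type A and let θ be either α ⊔ β or α ⊓ β in the lattice of setoids on A. If #(cl(α) △ cl(β)) ≥ ℵ₀, then #(cl(α) △ cl(β)) = max( #(cl(α) △ cl(θ)), #(cl(β) △ cl(θ)) ). (Lemma 9.12 (ii).) -/
open Cardinal
open scoped symmDiff

namespace Setoid

variable {A : Type*} {α β θ : Setoid A}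

theorem le_ker_mem_of_mem_classes {C : Set A} (hC : C ∈ α.classes) : α ≤ ker (· ∈ C) := by
  obtain ⟨a, rfl⟩ := hC
  exact fun x y hxy ↦ propext ⟨α.trans' (α.symm' hxy), α.trans' hxy⟩

theorem classes_inter_classes_subset_classes_sup (α β : Setoid A) :
    α.classes ∩ β.classes ⊆ (α ⊔ β).classes := by
  rintro C ⟨hα, hβ⟩
  have hker : α ⊔ β ≤ ker (· ∈ C) :=
    sup_le (le_ker_mem_of_mem_classes hα) (le_ker_mem_of_mem_classes hβ)
  obtain ⟨a, rfl⟩ := hα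
  refine ⟨a, Set.Subset.antisymm (fun x hx ↦ (le_sup_left : α ≤ α ⊔ β) hx) fun x hx ↦ ?_⟩
  exact (hker hx).mpr (α.refl' a)

theorem classes_inter_classes_subset_classes_inf (α β : Setoid A) :
    α.classes ∩ β.classes ⊆ (α ⊓ β).classes := by
  rintro C ⟨⟨a, rfl⟩, hβ⟩
  have hab : {x | α x a} = {x | β x a} :=
    eq_of_mem_classes hβ (α.refl' a) (mem_classes β a) (β.refl' a)
  exact ⟨a, Set.Subset.antisymm (fun x hx ↦ ⟨hx, hab.subset hx⟩) fun x hx ↦ hx.1⟩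

theorem mk_classes_symmDiff_le (hle : α ⊓ β ≤ θ) (hinter : α.classes ∩ β.classes ⊆ θ.classes)
    (h : ℵ₀ ≤ #↥(α.classes ∆ β.classes)) :
    #↥(α.classes ∆ θ.classes) ≤ #↥(α.classes ∆ β.classes) := by
  have hleft : #↥(α.classes \ θ.classes) ≤ #↥(α.classes ∆ β.classes) :=
    mk_le_mk_of_subset fun C hC ↦ Or.inl ⟨hC.1, fun hβ ↦ hC.2 (hinter ⟨hC.1, hβ⟩)⟩
  have hright : #↥(θ.classes \ α.classes) ≤ #↥(α.classes ∆ β.classes) := by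
    choose a ha using fun C : ↥(θ.classes \ α.classes) ↦ C.2.1
    have hnot (C : ↥(θ.classes \ α.classes)) {D : Set A} (haD : a C ∈ D) :
        ¬ (D ∈ α.classes ∧ D ∈ β.classes) := fun hD ↦ by
      have haC : a C ∈ (C : Set A) := (ha C).symm.subset (θ.refl' (a C))
      exact C.2.2 (eq_of_mem_classes (hinter hD) haD C.2.1 haC ▸ hD.1)
    let f (C : ↥(θ.classes \ α.classes)) : ↥(α.classes ∆ β.classes) × ↥(α.classes ∆ β.classes) :=
      (⟨{x | α x (a C)}, Or.inl ⟨mem_classes α _, fun hβ ↦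
          hnot C (D := {x | α x (a C)}) (α.refl' _) ⟨mem_classes α _, hβ⟩⟩⟩,
        ⟨{x | β x (a C)}, Or.inr ⟨mem_classes β _, fun hα ↦
          hnot C (D := {x | β x (a C)}) (β.refl' _) ⟨hα, mem_classes β _⟩⟩⟩)
    have hf : Function.Injective f := fun C D hCD ↦ by
      have hα : {x | α x (a C)} = {x | α x (a D)} := congrArg (fun p ↦ p.1.1) hCD
      have hβ : {x | β x (a C)} = {x | β x (a D)} := congrArg (fun p ↦ p.2.1) hCD
      have hθ : θ (a C) (a D) := hle ⟨hα.subset (α.refl' _), hβ.subset (β.refl' _)⟩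
      apply Subtype.ext
      rw [ha C, ha D]
      exact Set.ext fun x ↦ ⟨fun hx ↦ θ.trans' hx hθ, fun hx ↦ θ.trans' hx (θ.symm' hθ)⟩
    simpa [mul_eq_self h] using mk_le_of_injective hf
  exact (mk_union_le _ _).trans (add_le_of_le h hleft hright)

end Setoid

/-- Lemma 9.12 (ii): for setoids `α`, `β` on a type `A` and `θ` either `α ⊔ β` or
`α ⊓ β`, if `#(cl α △ cl β) ≥ ℵ₀` then
`#(cl α △ cl β) = max (#(cl α △ cl θ)) (#(cl β △ cl θ))`. -/
theorem classes_symmDiff_eq_max_of_infinite {A : Type*} (α β θ : Setoid A)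
    (hθ : θ = α ⊔ β ∨ θ = α ⊓ β) (h : ℵ₀ ≤ #↥(α.classes ∆ β.classes)) :
    #↥(α.classes ∆ β.classes) =
      max #↥(α.classes ∆ θ.classes) #↥(β.classes ∆ θ.classes) := by
  have hle : α ⊓ β ≤ θ := by
    rcases hθ with rfl | rfl
    exacts [inf_le_sup, le_rfl]
  have hinter : α.classes ∩ β.classes ⊆ θ.classes := by
    rcases hθ with rfl | rfl
    exacts [Setoid.classes_inter_classes_subset_classes_sup α β,
      Setoid.classes_inter_classes_subset_classes_inf α β]
  apply le_antisymm
  · have htri : #↥(α.classes ∆ β.classes) ≤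
        #↥(α.classes ∆ θ.classes) + #↥(β.classes ∆ θ.classes) := by
      rw [symmDiff_comm β.classes]
      exact (mk_le_mk_of_subset (symmDiff_triangle _ _ _)).trans (mk_union_le _ _)
    rcases le_or_gt ℵ₀ (max #↥(α.classes ∆ θ.classes) #↥(β.classes ∆ θ.classes)) with hmax | hmax
    · exact htri.trans (add_le_of_le hmax (le_max_left _ _) (le_max_right _ _))
    · exact absurd (h.trans htri) (add_lt_aleph0 (max_lt_iff.mp hmax).1
        (max_lt_iff.mp hmax).2).not_ge
  · refine max_le (Setoid.mk_classes_symmDiff_le hle hinter h) ?_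
    rw [inf_comm] at hle
    rw [Set.inter_comm] at hinter
    rw [symmDiff_comm α.classes] at h ⊢
    exact Setoid.mk_classes_symmDiff_le hle hinter h
end

section
/- Let Γ be a simple graph on an infinite vertex type V in which every vertex has only finitely many neighbours. Then Γ contains an independent set of cardinality #V, i.e. there is a set S of vertices with #S = #V such that no two distinct elements of S are adjacent in Γ. (Lemma 9.1.) -/
open Cardinal

theorem SimpleGraph.exists_maximal_isIndepSet {V : Type*} (Γ : SimpleGraph V) :
    ∃ S : Set V, Maximal Γ.IsIndepSet S := by
  refine zorn_subset {S | Γ.IsIndepSet S} fun c hc hchain ↦ ?_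
  refine ⟨⋃₀ c, ?_, fun s hs ↦ Set.subset_sUnion_of_mem hs⟩
  exact (Set.pairwise_sUnion hchain.directedOn).2 fun s hs ↦ hc hs

/-- A maximal independent set, together with its neighbours, covers the vertex set. -/
theorem SimpleGraph.iUnion_insert_neighborSet_eq_univ {V : Type*} {Γ : SimpleGraph V}
    {S : Set V} (hS : Maximal Γ.IsIndepSet S) :
    ⋃ s : S, insert (s : V) (Γ.neighborSet s) = Set.univ := by
  refine Set.eq_univ_of_forall fun v ↦ ?_
  by_contra hv
  simp only [Set.mem_iUnion, Set.mem_insert_iff, SimpleGraph.mem_neighborSet, Subtype.exists,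
    exists_prop, not_exists, not_and, not_or] at hv
  have hins : Γ.IsIndepSet (insert v S) :=
    hS.prop.insert fun s hs _ ↦ ⟨fun hadj ↦ (hv s hs).2 hadj.symm, (hv s hs).2⟩
  exact (hv v (hS.le_of_ge hins (Set.subset_insert v S) (Set.mem_insert v S))).1 rfl

/-- Lemma 9.1: a simple graph on an infinite vertex type `V` in which every vertex
has only finitely many neighbours contains an independent set of cardinality `#V`. -/
theorem exists_independent_set_of_locallyFinite {V : Type*} [Infinite V]
    (Γ : SimpleGraph V) (h : ∀ v : V, (Γ.neighborSet v).Finite) :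
    ∃ S : Set V, #↥S = #V ∧ ∀ a ∈ S, ∀ b ∈ S, a ≠ b → ¬ Γ.Adj a b := by
  obtain ⟨S, hS⟩ := Γ.exists_maximal_isIndepSet
  refine ⟨S, le_antisymm (mk_set_le S) ?_, fun a ha b hb hab ↦ hS.prop ha hb hab⟩
  have hcover := SimpleGraph.iUnion_insert_neighborSet_eq_univ hS
  have hfin (s : S) : (insert (s : V) (Γ.neighborSet s)).Finite := (h s).insert _
  have hinf : Infinite S := by
    by_contra hS_fin
    have : Finite S := not_infinite_iff_finite.1 hS_fin
    exact Set.infinite_univ (hcover ▸ Set.finite_iUnion hfin)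
  calc #V = #(⋃ s : S, insert (s : V) (Γ.neighborSet s)) := by rw [hcover, mk_univ]
    _ ≤ sum fun s : S ↦ #↥(insert (s : V) (Γ.neighborSet s)) := mk_iUnion_le_sum_mk
    _ ≤ sum fun _ : S ↦ ℵ₀ := sum_le_sum _ _ fun s ↦ (hfin s).lt_aleph0.le
    _ = #S * ℵ₀ := by simp
    _ = #S := mul_aleph0_eq (aleph0_le_mk S)
end

section
/- Let P and Q be well-ordered chains (linear orders whose strict order relation is well-founded). Then the set of antitone functions P → Q is well quasi-ordered under the pointwise order: for every sequence f₀, f₁, f₂, … of antitone functions P → Q there exist indices i < j with f_i(p) ≤ f_j(p) for all p ∈ P. (Proposition 8.7.) -/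
theorem Antitone.finite_range_of_wellFoundedLT {P Q : Type*} [LinearOrder P] [LinearOrder Q]
    [WellFoundedLT P] [WellFoundedLT Q] {f : P → Q} (hf : Antitone f) :
    (Set.range f).Finite := by
  by_contra h
  have hinf : (Set.range f).Infinite := h
  choose g hg using fun n => (hinf.natEmbedding _ n).2
  have hinj : Function.Injective fun n => f (g n) := fun m n hmn => by
    simp only [hg] at hmn
    exact (hinf.natEmbedding _).injective (Subtype.ext hmn)
  have hP : WellQuasiOrdered (α := P) (· ≤ ·) := wellQuasiOrdered_le
  obtain ⟨u, hu⟩ := hP.exists_monotone_subseq g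
  have hQ : WellQuasiOrdered (α := Q) (· ≤ ·) := wellQuasiOrdered_le
  obtain ⟨m, n, hmn, hle⟩ := hQ fun k => f (g (u k))
  exact hmn.ne (u.injective (hinj (hle.antisymm (hf (hu m n hmn.le)))))

/-- The region below the graph of an antitone function between well-ordered chains is a finite
union of rectangles. -/
theorem Antitone.exists_list_rectangles {P Q : Type*} [LinearOrder P] [LinearOrder Q]
    [WellFoundedLT P] [WellFoundedLT Q] {f : P → Q} (hf : Antitone f) :
    ∃ L : List (WithTop P × Q),
      (∀ p : P, ∃ x ∈ L, ↑p < x.1 ∧ f p = x.2) ∧ ∀ x ∈ L, ∀ p : P, ↑p < x.1 → x.2 ≤ f p := by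
  have corner (q : Q) : ∃ a : WithTop P, ∀ p : P, ↑p < a ↔ q ≤ f p := by
    have hne : {a : WithTop P | ∀ p : P, q ≤ f p → ↑p < a}.Nonempty :=
      ⟨⊤, fun p _ => WithTop.coe_lt_top p⟩
    obtain ⟨a, ha, hmin⟩ := WellFounded.has_min (wellFounded_lt (α := WithTop P)) _ hne
    refine ⟨a, fun p => ⟨fun hp => ?_, ha p⟩⟩
    by_contra hq
    refine hmin p (fun p' hp' => ?_) hp
    exact WithTop.coe_lt_coe.2 (lt_of_not_ge fun hle => hq (hp'.trans (hf hle)))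
  choose a ha using corner
  refine ⟨hf.finite_range_of_wellFoundedLT.toFinset.toList.map fun q => (a q, q), ?_, ?_⟩
  · intro p
    exact ⟨(a (f p), f p), by simp, (ha _ p).2 le_rfl, rfl⟩
  · intro x hx p hp
    obtain ⟨q, -, rfl⟩ := List.mem_map.1 hx
    exact (ha q p).1 hp

/-- Proposition 8.7: if `P` and `Q` are well-ordered chains, then the antitone
functions `P → Q` are well quasi-ordered under the pointwise order: any sequence
`f₀, f₁, f₂, …` of antitone functions contains indices `i < j` with
`f i p ≤ f j p` for all `p`. -/
theorem antitone_wqo {P Q : Type*} [LinearOrder P] [LinearOrder Q]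
    [WellFoundedLT P] [WellFoundedLT Q]
    (f : ℕ → P → Q) (hf : ∀ n, Antitone (f n)) :
    ∃ i j, i < j ∧ ∀ p : P, f i p ≤ f j p := by
  choose L hcover hbelow using fun n => (hf n).exists_list_rectangles
  have hpwo : (Set.univ : Set (WithTop P × Q)).PartiallyWellOrderedOn (· ≤ ·) :=
    Set.isPWO_of_wellQuasiOrderedLE _
  obtain ⟨i, j, hij, hsub⟩ :=
    (hpwo.partiallyWellOrderedOn_sublistForall₂ (· ≤ ·)).exists_lt (f := L) (by simp)
  refine ⟨i, j, hij, fun p => ?_⟩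
  obtain ⟨l, hl, hlj⟩ := List.sublistForall₂_iff.1 hsub
  obtain ⟨x, hx, hpx, hfx⟩ := hcover i p
  obtain ⟨k, hk, rfl⟩ := List.mem_iff_getElem.1 hx
  have hk' : k < l.length := hl.length_eq ▸ hk
  have hle : (L i)[k] ≤ l[k] := hl.get hk hk'
  calc f i p = (L i)[k].2 := hfx
    _ ≤ l[k].2 := hle.2
    _ ≤ f j p := hbelow j _ (hlj.subset (List.getElem_mem hk')) p (hpx.trans_le hle.1)
end

section
/- Let M be a type with a multiplication, let c be a congruence on M, let P be a well-ordered chain, and let σ : P → Con M be a monotone family of congruences such that σ(p) ≠ c for every p ∈ P and such that c is the union of the family, i.e. c x y holds iff σ(p) x y for some p ∈ P. Then for every binary relation r on M with conGen r = c, there exists a cofinal subset Q of P with #Q ≤ #{(x,y) : r x y}. (Lemma 7.1: the rank of such a congruence is at least the cofinality of P.) -/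
open Cardinal

universe u v

/-- Lemma 7.1: if a congruence `c` on a multiplicative structure `M` is the union of
a monotone family `σ : P → Con M` of proper subcongruences indexed by a well-ordered
chain `P`, then for any relation `r` generating `c` there is a cofinal subset `Q` of
`P` with `#Q ≤ #{(x,y) : r x y}`; hence the rank of `c` is at least the cofinality
of `P`. -/
theorem cofinal_subset_of_generating_set {M : Type u} [Mul M] {P : Type v}
    [LinearOrder P] [WellFoundedLT P]
    (c : Con M) (σ : P → Con M) (hmono : Monotone σ)
    (hproper : ∀ p : P, σ p ≠ c)
    (hunion : ∀ x y : M, c x y ↔ ∃ p : P, σ p x y)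
    (r : M → M → Prop) (hr : conGen r = c) :
    ∃ Q : Set P, (∀ p : P, ∃ q ∈ Q, p ≤ q) ∧
      Cardinal.lift.{u} #↥Q ≤ Cardinal.lift.{v} #{z : M × M // r z.1 z.2} := by
  have hc : ∀ z : {z : M × M // r z.1 z.2}, ∃ p : P, σ p z.1.1 z.1.2 := fun z =>
    (hunion _ _).1 (hr ▸ ConGen.Rel.of _ _ z.2)
  choose f hf using hc
  refine ⟨Set.range f, fun p => ?_, mk_range_le_lift⟩
  by_contra! hlt
  refine hproper p (le_antisymm (fun {x y} h => (hunion x y).2 ⟨p, h⟩) ?_)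
  rw [← hr]
  exact Con.conGen_le.2 fun x y hxy =>
    hmono (hlt _ ⟨⟨(x, y), hxy⟩, rfl⟩).le (hf ⟨(x, y), hxy⟩)
end

section
/- Let X be a set. For f, g : X → X, set X₀ = {x : f x ≠ g x} and drank(f,g) = max( #(f '' X₀), #(g '' X₀) ). Then drank(f,g) ≤ #(cl(τ f) △ cl(τ g)) ≤ 4·drank(f,g); in particular, if either drank(f,g) or #(cl(τ f) △ cl(τ g)) is zero or infinite, then drank(f,g) = #(cl(τ f) △ cl(τ g)). (Lemma 10.4.) -/
open Cardinal
open scoped symmDiff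

namespace TransformationsAsPartitions

variable {X : Type*}

/-- The partition over `X` realizing a transformation `f : X → X`: the kernel of
`Sum.elim f id : X ⊕ X → X`. -/
def tau (f : X → X) : Setoid (X ⊕ X) := Setoid.ker (Sum.elim f id)

/-- The difference rank of two transformations. -/
noncomputable def drank (f g : X → X) : Cardinal :=
  max #↥(f '' {x | f x ≠ g x}) #↥(g '' {x | f x ≠ g x})

/-- The class of `tau f` containing `Sum.inr b`. -/
def block (f : X → X) (b : X) : Set (X ⊕ X) := {z | Sum.elim f id z = b}

theorem inr_mem_block {f : X → X} {b c : X} : Sum.inr c ∈ block f b ↔ c = b := Iff.rfl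

theorem inl_mem_block {f : X → X} {b x : X} : Sum.inl x ∈ block f b ↔ f x = b := Iff.rfl

theorem eq_of_block_eq {f g : X → X} {b c : X} (h : block f b = block g c) : b = c :=
  inr_mem_block.1 (h ▸ inr_mem_block.2 rfl)

theorem block_injective (f : X → X) : Function.Injective (block f) := fun _ _ => eq_of_block_eq

theorem classes_tau (f : X → X) : (tau f).classes = Set.range (block f) := by
  ext s
  constructor
  · rintro ⟨y, rfl⟩
    exact ⟨Sum.elim f id y, rfl⟩
  · rintro ⟨b, rfl⟩
    exact ⟨Sum.inr b, rfl⟩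

theorem block_ne_iff {f g : X → X} {b : X} :
    block f b ≠ block g b ↔ b ∈ f '' {x | f x ≠ g x} ∪ g '' {x | f x ≠ g x} := by
  constructor
  · intro h
    contrapose! h
    simp only [Set.mem_union, Set.mem_image, Set.mem_ofPred_eq, not_or, not_exists, not_and] at h
    ext (x | c)
    · rw [inl_mem_block, inl_mem_block]
      grind
    · rw [inr_mem_block, inr_mem_block]
  · rintro (⟨x, hx, rfl⟩ | ⟨x, hx, rfl⟩) h
    · exact hx (inl_mem_block.1 (h ▸ inl_mem_block.2 rfl : Sum.inl x ∈ block g (f x))).symm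
    · exact hx (inl_mem_block.1 (h.symm ▸ inl_mem_block.2 rfl : Sum.inl x ∈ block f (g x)))

theorem classes_diff (f g : X → X) :
    (tau f).classes \ (tau g).classes =
      block f '' (f '' {x | f x ≠ g x} ∪ g '' {x | f x ≠ g x}) := by
  rw [classes_tau, classes_tau]
  ext s
  constructor
  · rintro ⟨⟨b, rfl⟩, h⟩
    exact ⟨b, block_ne_iff.1 fun e => h ⟨b, e.symm⟩, rfl⟩
  · rintro ⟨b, hb, rfl⟩
    refine ⟨⟨b, rfl⟩, ?_⟩
    rintro ⟨c, hc⟩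
    obtain rfl := eq_of_block_eq hc
    exact block_ne_iff.2 hb hc.symm

theorem mk_classes_diff (f g : X → X) :
    #↥((tau f).classes \ (tau g).classes) =
      #↥(f '' {x | f x ≠ g x} ∪ g '' {x | f x ≠ g x}) := by
  rw [classes_diff, mk_image_eq (block_injective f)]

/-- Each side of the symmetric difference has one class for every point where the fibres of
`f` and `g` differ. -/
theorem mk_symmDiff_classes (f g : X → X) :
    #↥((tau f).classes ∆ (tau g).classes) =
      2 * #↥(f '' {x | f x ≠ g x} ∪ g '' {x | f x ≠ g x}) := by
  have hg := mk_classes_diff g f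
  simp only [ne_comm (a := g _), Set.union_comm (g '' _)] at hg
  rw [Set.symmDiff_def, mk_union_of_disjoint disjoint_sdiff_sdiff, mk_classes_diff, hg, two_mul]

/-- Lemma 10.4: `drank(f,g) ≤ #(τf △ τg) ≤ 4·drank(f,g)`; in particular, if either
quantity is zero or infinite then they are equal. -/
theorem drank_le_symmDiff_le (f g : X → X) :
    (drank f g ≤ #↥((tau f).classes ∆ (tau g).classes) ∧
      #↥((tau f).classes ∆ (tau g).classes) ≤ 4 * drank f g) ∧
    ((drank f g = 0 ∨ ℵ₀ ≤ drank f g ∨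
        #↥((tau f).classes ∆ (tau g).classes) = 0 ∨
        ℵ₀ ≤ #↥((tau f).classes ∆ (tau g).classes)) →
      drank f g = #↥((tau f).classes ∆ (tau g).classes)) := by
  set s := #↥((tau f).classes ∆ (tau g).classes) with hs
  have lower : drank f g ≤ s := by
    rw [hs, mk_symmDiff_classes, two_mul]
    exact (max_le (mk_le_mk_of_subset Set.subset_union_left)
      (mk_le_mk_of_subset Set.subset_union_right)).trans (self_le_add_right _ _)
  have upper : s ≤ 4 * drank f g := by
    calc s = 2 * #↥(f '' {x | f x ≠ g x} ∪ g '' {x | f x ≠ g x}) := mk_symmDiff_classes f g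
      _ ≤ 2 * (drank f g + drank f g) := by
        gcongr
        exact (mk_union_le _ _).trans (add_le_add (le_max_left _ _) (le_max_right _ _))
      _ = 4 * drank f g := by ring
  have of_infinite (h : ℵ₀ ≤ drank f g) : drank f g = s :=
    lower.antisymm (upper.trans_eq (mul_eq_right h (ofNat_lt_aleph0.le.trans h) four_ne_zero))
  refine ⟨⟨lower, upper⟩, ?_⟩
  rintro (h | h | h | h)
  · exact lower.antisymm (by simpa [h] using upper)
  · exact of_infinite h
  · exact lower.antisymm (h.trans_le zero_le)
  · refine of_infinite (not_lt.1 fun hd => ?_)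
    exact (h.trans upper).not_gt (mul_lt_aleph0 ofNat_lt_aleph0 hd)

end TransformationsAsPartitions
end

section
/- Let X be an infinite set and let ξ be a cardinal with ξ = 1 or ℵ₀ ≤ ξ ≤ (#X)⁺. On the full transformation monoid T_X = Function.End X (all maps X → X under composition), the relation Δ_ξ, defined by (f,g) ∈ Δ_ξ iff drank(f,g) < ξ where X₀ = {x : f x ≠ g x} and drank(f,g) = max( #(f '' X₀), #(g '' X₀) ), is a congruence: there is c ∈ Con (Function.End X) with c f g ↔ drank(f,g) < ξ for all f, g. (Section 10.2, Mal'cev's Δ_ξ relations; cf. Lemma 4.15.) -/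
open Cardinal

namespace TransformationCongruences

variable {X : Type*}

/-- The difference rank of two transformations `f, g : X → X`. -/
noncomputable def drank (f g : X → X) : Cardinal :=
  max #↥(f '' {x | f x ≠ g x}) #↥(g '' {x | f x ≠ g x})

theorem drank_self (f : X → X) : drank f f = 0 := by
  simp [drank]

theorem drank_comm (f g : X → X) : drank f g = drank g f := by
  simp only [drank, ne_comm (a := f _)]
  exact max_comm _ _

theorem mk_image_le_drank (f g : X → X) : #↥(f '' {x | f x ≠ g x}) ≤ drank f g :=
  le_max_left _ _

theorem mk_image_trans_le (f g h : X → X) :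
    #↥(f '' {x | f x ≠ h x}) ≤ drank f g + drank g h := by
  have hsub : f '' {x | f x ≠ h x} ⊆ f '' {x | f x ≠ g x} ∪ g '' {x | g x ≠ h x} := by
    rintro _ ⟨x, hx, rfl⟩
    by_cases hfg : f x = g x
    · exact Or.inr ⟨x, fun hgh => hx (hfg.trans hgh), hfg.symm⟩
    · exact Or.inl ⟨x, hfg, rfl⟩
  exact (mk_le_mk_of_subset hsub).trans <| (mk_union_le _ _).trans <|
    add_le_add (mk_image_le_drank f g) (mk_image_le_drank g h)

theorem drank_triangle (f g h : X → X) : drank f h ≤ drank f g + drank g h := by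
  refine max_le (mk_image_trans_le f g h) ?_
  have key := mk_image_trans_le h g f
  rw [drank_comm h g, drank_comm g f, add_comm] at key
  simpa only [ne_comm (a := h _)] using key

theorem mk_image_comp_le (f g f' g' : X → X) :
    #↥((f ∘ f') '' {x | (f ∘ f') x ≠ (g ∘ g') x}) ≤ drank f g + drank f' g' := by
  have hsub : (f ∘ f') '' {x | (f ∘ f') x ≠ (g ∘ g') x} ⊆
      f '' {x | f x ≠ g x} ∪ f '' (f' '' {x | f' x ≠ g' x}) := by
    rintro _ ⟨x, hx, rfl⟩
    by_cases hfg : f' x = g' x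
    · exact Or.inl ⟨f' x, fun h => hx (h.trans (congrArg g hfg)), rfl⟩
    · exact Or.inr ⟨f' x, ⟨x, hfg, rfl⟩, rfl⟩
  exact (mk_le_mk_of_subset hsub).trans <| (mk_union_le _ _).trans <|
    add_le_add (mk_image_le_drank f g) (mk_image_le.trans (mk_image_le_drank f' g'))

theorem drank_comp_le (f g f' g' : X → X) :
    drank (f ∘ f') (g ∘ g') ≤ drank f g + drank f' g' := by
  refine max_le (mk_image_comp_le f g f' g') ?_
  have key := mk_image_comp_le g f g' f'
  rw [drank_comm g f, drank_comm g' f'] at key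
  simpa only [ne_comm (a := (g ∘ g') _)] using key

/-- Mal'cev's relations `Δ_ξ` (cf. Lemma 4.15): for an infinite set `X` and a
cardinal `ξ` with `ξ = 1` or `ℵ₀ ≤ ξ ≤ (#X)⁺`, the relation
`{(f,g) : drank(f,g) < ξ}` is a congruence on the full transformation monoid
`T_X = Function.End X`. -/
theorem delta_isCongruence [Infinite X] (ξ : Cardinal)
    (hξ : ξ = 1 ∨ (ℵ₀ ≤ ξ ∧ ξ ≤ Order.succ #X)) :
    ∃ c : Con (Function.End X), ∀ f g : Function.End X,
      c f g ↔ drank f g < ξ := by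
  have hpos : 0 < ξ := by
    rcases hξ with rfl | ⟨h, -⟩
    · exact zero_lt_one
    · exact aleph0_pos.trans_le h
  have hadd {a b : Cardinal} (ha : a < ξ) (hb : b < ξ) : a + b < ξ := by
    rcases hξ with rfl | ⟨h, -⟩
    · rw [Cardinal.lt_one_iff] at ha hb
      simp [ha, hb]
    · exact add_lt_of_lt h ha hb
  exact ⟨{
    r := fun f g => drank f g < ξ
    iseqv :=
      { refl := fun f => (drank_self f).trans_lt hpos
        symm := fun {f g} h => (drank_comm g f).trans_lt h
        trans := fun {f g h} hfg hgh => (drank_triangle f g h).trans_lt (hadd hfg hgh) }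
    mul' := fun {f g f' g'} h h' => (drank_comp_le f g f' g').trans_lt (hadd h h') },
    fun _ _ => Iff.rfl⟩

end TransformationCongruences
end

section
/- Let X be an infinite set and let σ be a congruence on the partition monoid P_X. If (α,β) ∈ σ with rank(α) > rank(β), then for every γ ∈ P_X with rank(γ) ≤ rank(α) we have (γ, γ̂) ∈ σ, where γ̂ denotes the unique rank-0 partition with the same kernel and cokernel as γ (the setoid relating inl x to inl y iff γ does, relating inr x to inr y iff γ does, and relating no element of the left summand to any element of the right summand). (Lemma 5.8.) -/
open Cardinal
open scoped symmDiff

namespace PartitionCongruences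

variable {X : Type*}

/-- The unique rank-0 partition `γ̂` with the same kernel and cokernel as `γ`:
it relates `inl x` to `inl y` (resp. `inr x` to `inr y`) iff `γ` does, and relates
no element of the left summand to any element of the right summand. -/
def hat (γ : PMon X) : PMon X := γ ⊓ Setoid.ker Sum.isLeft

/-- The three-level setoid whose restriction to the outer levels is `α * β`. -/
def stacked (α β : PMon X) : Setoid (X ⊕ (X ⊕ X)) := push (dmap X) α ⊔ push (umap X) β

lemma mul_rel {α β : PMon X} {z w : X ⊕ X} :
    (α * β) z w ↔ stacked α β (emap X z) (emap X w) := Iff.rfl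

lemma push_le {A B : Type*} {f : A → B} {σ : Setoid A} {s : Setoid B}
    (h : ∀ x y, σ x y → s (f x) (f y)) : push f σ ≤ s := by
  refine Setoid.eqvGen_le ?_
  rintro _ _ ⟨x, y, hxy, rfl, rfl⟩
  exact h x y hxy

lemma stacked_le {α β : PMon X} {s : Setoid (X ⊕ (X ⊕ X))}
    (hα : ∀ z w, α z w → s (dmap X z) (dmap X w))
    (hβ : ∀ z w, β z w → s (umap X z) (umap X w)) : stacked α β ≤ s :=
  sup_le (push_le hα) (push_le hβ)

lemma stacked_left {α : PMon X} (β : PMon X) {z w : X ⊕ X} (h : α z w) :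
    stacked α β (dmap X z) (dmap X w) :=
  (le_sup_left : push (dmap X) α ≤ stacked α β) (Relation.EqvGen.rel _ _ ⟨z, w, h, rfl, rfl⟩)

lemma stacked_right (α : PMon X) {β : PMon X} {z w : X ⊕ X} (h : β z w) :
    stacked α β (umap X z) (umap X w) :=
  (le_sup_right : push (umap X) β ≤ stacked α β) (Relation.EqvGen.rel _ _ ⟨z, w, h, rfl, rfl⟩)

lemma mul_inl_inl {α : PMon X} (β : PMon X) {x y : X} (h : α (.inl x) (.inl y)) :
    (α * β) (.inl x) (.inl y) := stacked_left β h

lemma mul_inr_inr (α : PMon X) {β : PMon X} {x y : X} (h : β (.inr x) (.inr y)) :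
    (α * β) (.inr x) (.inr y) := stacked_right α h

lemma mul_inl_inr {α β : PMon X} {x m y : X} (h : α (.inl x) (.inr m))
    (h' : β (.inl m) (.inr y)) : (α * β) (.inl x) (.inr y) :=
  (stacked α β).trans (stacked_left β h) (stacked_right α h')

lemma mul_inl_inl_of_middle {α β : PMon X} {x m n y : X} (h : α (.inl x) (.inr m))
    (h' : β (.inl m) (.inl n)) (h'' : α (.inr n) (.inl y)) : (α * β) (.inl x) (.inl y) :=
  (stacked α β).trans (stacked_left β h)
    ((stacked α β).trans (stacked_right α h') (stacked_left β h''))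

/-- If `f` on the three levels is constant on blocks of both factors, it is constant on
blocks of the product. -/
lemma mul_le_ker {V : Type*} {α β : PMon X} (f g h : X → V)
    (hα : α ≤ Setoid.ker (Sum.elim f g)) (hβ : β ≤ Setoid.ker (Sum.elim g h)) :
    α * β ≤ Setoid.ker (Sum.elim f h) := by
  intro z w hzw
  have key : stacked α β ≤ Setoid.ker (Sum.elim f (Sum.elim g h)) := by
    refine stacked_le (fun z w hzw => ?_) (fun z w hzw => ?_)
    · have := hα hzw
      rcases z with z | z <;> rcases w with w | w <;> exact this
    · have := hβ hzw
      rcases z with z | z <;> rcases w with w | w <;> exact this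
  have := key (mul_rel.1 hzw)
  rcases z with z | z <;> rcases w with w | w <;> exact this

lemma not_mul_of_isolated_left {α : PMon X} (β : PMon X) {x : X}
    (h : ∀ z, α (.inl x) z → z = .inl x) (z : X ⊕ X) (hz : (α * β) (.inl x) z) :
    z = .inl x := by
  have := mul_le_ker (α := α) (β := β) (fun y => y = x) (fun _ => False) (fun _ => False) ?_ ?_ hz
  · rcases z with z | z <;> simp_all [Setoid.ker_def]
  · intro z w hzw
    have h1 : ∀ y u, α (.inl y) u → y = x → u = .inl x := by
      rintro y u hy rfl
      exact h u hy
    rw [Setoid.ker_def]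
    rcases z with z | z <;> rcases w with w | w <;> simp only [Sum.elim_inl, Sum.elim_inr]
    · exact propext ⟨fun e => Sum.inl_injective (h1 _ _ hzw e),
        fun e => Sum.inl_injective (h1 _ _ (α.symm hzw) e)⟩
    · exact eq_false fun e => nomatch h1 _ _ hzw e
    · exact (eq_false fun e => nomatch h1 _ _ (α.symm hzw) e).symm
  · intro z w _
    rw [Setoid.ker_def]
    rcases z with z | z <;> rcases w with w | w <;> rfl

lemma not_mul_of_isolated_right (α : PMon X) {β : PMon X} {y : X}
    (h : ∀ z, β (.inr y) z → z = .inr y) (z : X ⊕ X) (hz : (α * β) (.inr y) z) :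
    z = .inr y := by
  have := mul_le_ker (α := α) (β := β) (fun _ => False) (fun _ => False) (fun x => x = y) ?_ ?_ hz
  · rcases z with z | z <;> simp_all [Setoid.ker_def]
  · intro z w _
    rw [Setoid.ker_def]
    rcases z with z | z <;> rcases w with w | w <;> rfl
  · intro z w hzw
    have h1 : ∀ x u, β (.inr x) u → x = y → u = .inr y := by
      rintro x u hx rfl
      exact h u hx
    rw [Setoid.ker_def]
    rcases z with z | z <;> rcases w with w | w <;> simp only [Sum.elim_inl, Sum.elim_inr]
    · exact (eq_false fun e => nomatch h1 _ _ (β.symm hzw) e).symm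
    · exact eq_false fun e => nomatch h1 _ _ hzw e
    · exact propext ⟨fun e => Sum.inr_injective (h1 _ _ hzw e),
        fun e => Sum.inr_injective (h1 _ _ (β.symm hzw) e)⟩

/-- The transversals of a partition. -/
abbrev Transversal (α : PMon X) := {B : Set (X ⊕ X) // IsTransversal α B}

lemma IsTransversal.rel {α : PMon X} {B : Set (X ⊕ X)} (hB : IsTransversal α B) {z w : X ⊕ X}
    (hz : z ∈ B) (hw : w ∈ B) : α z w := by
  obtain ⟨⟨u, rfl⟩, -⟩ := hB
  exact α.trans hz (α.symm hw)

lemma IsTransversal.mem_of_rel {α : PMon X} {B : Set (X ⊕ X)} (hB : IsTransversal α B)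
    {z w : X ⊕ X} (hz : z ∈ B) (h : α z w) : w ∈ B := by
  obtain ⟨⟨u, rfl⟩, -⟩ := hB
  exact α.trans (α.symm h) hz

namespace Transversal

variable {α : PMon X}

lemma eq_of_rel {s t : Transversal α} {z w : X ⊕ X} (hz : z ∈ s.1) (hw : w ∈ t.1)
    (h : α z w) : s = t := by
  refine Subtype.ext (Set.ext fun u => ⟨fun hu => ?_, fun hu => ?_⟩)
  · exact t.2.mem_of_rel hw (α.trans (α.symm h) (s.2.rel hz hu))
  · exact s.2.mem_of_rel hz (α.trans h (t.2.rel hw hu))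

lemma exists_mem {x y : X} (h : α (.inl x) (.inr y)) :
    ∃ t : Transversal α, Sum.inl x ∈ t.1 ∧ Sum.inr y ∈ t.1 :=
  ⟨⟨{z | α z (.inl x)}, ⟨_, rfl⟩, ⟨x, α.refl _⟩, ⟨y, α.symm h⟩⟩, α.refl _, α.symm h⟩

end Transversal

section Rank

universe u
variable {X : Type u}

lemma rank_le_mk {ρ : PMon X} {S : Type u} (R : X ⊕ X → S → Prop)
    (h : ∀ x y, ρ (.inl x) (.inr y) → ∃ z s, ρ (.inl x) z ∧ R z s)
    (hR : ∀ z w s, R z s → R w s → ρ z w) : rank ρ ≤ #S := by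
  have key (t : Transversal ρ) : ∃ s z, z ∈ t.1 ∧ R z s := by
    obtain ⟨x, hx⟩ := t.2.2.1
    obtain ⟨y, hy⟩ := t.2.2.2
    obtain ⟨z, s, hz, hs⟩ := h x y (t.2.rel hx hy)
    exact ⟨s, z, t.2.mem_of_rel hx hz, hs⟩
  choose f z hz hf using key
  refine Cardinal.mk_le_of_injective (f := f) fun s t hst => ?_
  exact Transversal.eq_of_rel (hz s) (hz t) (hR _ _ _ (hf s) (hst ▸ hf t))

lemma mk_le_rank {ρ : PMon X} {S : Type u} (f g : S → X)
    (h : ∀ s, ρ (.inl (f s)) (.inr (g s)))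
    (hf : ∀ s t, ρ (.inl (f s)) (.inl (f t)) → s = t) : #S ≤ rank ρ := by
  choose T hT _ using fun s => Transversal.exists_mem (h s)
  exact Cardinal.mk_le_of_injective (f := T) fun s t hst =>
    hf s t ((T s).2.rel (hT s) (hst ▸ hT t))

lemma rank_eq_zero_iff {ρ : PMon X} :
    rank ρ = 0 ↔ ∀ x y, ¬ ρ (.inl x) (.inr y) := by
  rw [rank, Cardinal.mk_eq_zero_iff]
  constructor
  · intro h x y hxy
    exact h.elim (Transversal.exists_mem hxy).choose
  · refine fun h => ⟨fun t => ?_⟩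
    obtain ⟨x, hx⟩ := t.2.2.1
    obtain ⟨y, hy⟩ := t.2.2.2
    exact h x y (t.2.rel hx hy)

lemma rank_mul_le_left (α β : PMon X) : rank (α * β) ≤ rank α := by
  refine rank_le_mk (fun z (t : Transversal α) => z.isLeft ∧ z ∈ t.1) ?_ ?_
  · intro x y hxy
    by_contra! hcon
    have hno (x' m : X) (h' : (α * β) (.inl x) (.inl x')) : ¬ α (.inl x') (.inr m) := fun h =>
      have ⟨t, ht, _⟩ := Transversal.exists_mem h
      hcon _ t h' rfl ht
    have := mul_le_ker (α := α) (β := β) (fun y => (α * β) (.inl x) (.inl y)) (fun _ => False)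
      (fun _ => False) ?_ ?_ hxy
    · rw [Setoid.ker_def] at this
      exact this.mp ((α * β).refl _)
    · intro z w hzw
      rw [Setoid.ker_def]
      rcases z with z | z <;> rcases w with w | w <;> simp only [Sum.elim_inl, Sum.elim_inr]
      · exact propext ⟨fun e => (α * β).trans e (mul_inl_inl β hzw),
          fun e => (α * β).trans e (mul_inl_inl β (α.symm hzw))⟩
      · exact eq_false fun e => hno _ _ e hzw
      · exact (eq_false fun e => hno _ _ e (α.symm hzw)).symm
    · intro z w _
      rw [Setoid.ker_def]
      rcases z with z | z <;> rcases w with w | w <;> rfl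
  · rintro (z | z) (w | w) t ⟨hz, hzt⟩ ⟨hw, hwt⟩ <;> simp at hz hw
    exact mul_inl_inl β (t.2.rel hzt hwt)

lemma rank_mul_le_right (α β : PMon X) : rank (α * β) ≤ rank β := by
  refine rank_le_mk (fun z (t : Transversal β) => z.isRight ∧ z ∈ t.1) ?_ ?_
  · intro x y hxy
    by_contra! hcon
    have hno (y' m : X) (h' : (α * β) (.inl x) (.inr y')) : ¬ β (.inl m) (.inr y') := fun h =>
      have ⟨t, _, ht⟩ := Transversal.exists_mem h
      hcon _ t h' rfl ht
    have := mul_le_ker (α := α) (β := β) (fun _ => False) (fun _ => False)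
      (fun y => (α * β) (.inl x) (.inr y)) ?_ ?_ hxy
    · rw [Setoid.ker_def] at this
      exact this.mpr hxy
    · intro z w _
      rw [Setoid.ker_def]
      rcases z with z | z <;> rcases w with w | w <;> rfl
    · intro z w hzw
      rw [Setoid.ker_def]
      rcases z with z | z <;> rcases w with w | w <;> simp only [Sum.elim_inl, Sum.elim_inr]
      · exact (eq_false fun e => hno _ _ e hzw).symm
      · exact eq_false fun e => hno _ _ e (β.symm hzw)
      · exact propext ⟨fun e => (α * β).trans e (mul_inr_inr α hzw),
          fun e => (α * β).trans e (mul_inr_inr α (β.symm hzw))⟩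
  · rintro (z | z) (w | w) t ⟨hz, hzt⟩ ⟨hw, hwt⟩ <;> simp at hz hw
    exact mul_inr_inr α (t.2.rel hzt hwt)

lemma rank_mul_mul_le (l δ r : PMon X) : rank (l * δ * r) ≤ rank δ :=
  (rank_mul_le_left _ _).trans (rank_mul_le_right _ _)

/-- Partitions of rank at most `rank α` are two-sided multiples of `α`. -/
lemma exists_eq_mul_mul {γ α : PMon X} (h : rank γ ≤ rank α) :
    ∃ l r : PMon X, γ = l * α * r := by
  classical
  obtain ⟨e⟩ := h
  let q (x : X ⊕ X) : Option (Quotient γ) := some (Quotient.mk γ x)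
  have hq {z w} : q z = q w ↔ γ z w := by simp only [q, Option.some_inj]; exact Quotient.eq
  choose a ha using fun t : Transversal γ => t.2.2.1
  let w (z : X ⊕ X) : Option (Quotient γ) :=
    if h : ∃ t : Transversal γ, z ∈ (e t).1 then q (.inl (a h.choose)) else none
  have hw {t z} (hz : z ∈ (e t).1) : w z = q (.inl (a t)) := by
    have h : ∃ t : Transversal γ, z ∈ (e t).1 := ⟨t, hz⟩
    have : h.choose = t := e.injective (Transversal.eq_of_rel h.choose_spec hz (α.refl _))
    simp only [w, dif_pos h, this]
  have hαw : α ≤ Setoid.ker w := by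
    intro z z' hz
    rw [Setoid.ker_def]
    by_cases h : ∃ t : Transversal γ, z ∈ (e t).1
    · obtain ⟨t, ht⟩ := h
      rw [hw ht, hw ((e t).2.mem_of_rel ht hz)]
    · have h' : ¬ ∃ t : Transversal γ, z' ∈ (e t).1 := fun ⟨t, ht⟩ =>
        h ⟨t, (e t).2.mem_of_rel ht (α.symm hz)⟩
      simp only [w, dif_neg h, dif_neg h']
  have hγ (x y : X) (hxy : γ (.inl x) (.inr y)) :
      ∃ m n, w (.inl m) = q (.inl x) ∧ α (.inl m) (.inr n) ∧ w (.inr n) = q (.inr y) := by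
    obtain ⟨t, hx, hy⟩ := Transversal.exists_mem hxy
    obtain ⟨m, hm⟩ := (e t).2.2.1
    obtain ⟨n, hn⟩ := (e t).2.2.2
    exact ⟨m, n, (hw hm).trans (hq.2 (t.2.rel (ha t) hx)), (e t).2.rel hm hn,
      (hw hn).trans (hq.2 (t.2.rel (ha t) hy))⟩
  let l : PMon X := Setoid.ker (Sum.elim (q ∘ .inl) (w ∘ .inl))
  let r : PMon X := Setoid.ker (Sum.elim (w ∘ .inr) (q ∘ .inr))
  have hmix (x y : X) (hxy : γ (.inl x) (.inr y)) : (l * α * r) (.inl x) (.inr y) := by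
    obtain ⟨m, n, hm, hmn, hn⟩ := hγ x y hxy
    exact mul_inl_inr (mul_inl_inr hm.symm hmn) hn
  refine ⟨l, r, le_antisymm ?_ ?_⟩
  · rintro (z | z) (z' | z') hz
    · exact mul_inl_inl r (mul_inl_inl α (hq.2 hz))
    · exact hmix _ _ hz
    · exact (l * α * r).symm (hmix _ _ (γ.symm hz))
    · exact mul_inr_inr _ (hq.2 hz)
  · intro z z' hz
    have := mul_le_ker _ _ _ (mul_le_ker _ _ (w ∘ .inr) le_rfl (by simpa using hαw)) le_rfl hz
    rw [Setoid.ker_def] at this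
    exact hq.1 (by rcases z with z | z <;> rcases z' with z' | z' <;> exact this)

end Rank

/-- The partial identity on `A`: its transversals are `{a, a'}` for `a ∈ A` and all its
other blocks are singletons. -/
def partialId (A : Set X) : PMon X where
  r z w := z = w ∨ ∃ a ∈ A, (z = .inl a ∨ z = .inr a) ∧ (w = .inl a ∨ w = .inr a)
  iseqv := by
    refine ⟨fun _ => .inl rfl, ?_, ?_⟩
    · grind
    · grind

lemma partialId_rel {A : Set X} {z w : X ⊕ X} : partialId A z w ↔
    z = w ∨ ∃ a ∈ A, (z = .inl a ∨ z = .inr a) ∧ (w = .inl a ∨ w = .inr a) := Iff.rfl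

lemma partialId_mem {A : Set X} {a : X} (h : a ∈ A) : partialId A (.inl a) (.inr a) :=
  .inr ⟨a, h, .inl rfl, .inr rfl⟩

lemma partialId_le_ker {V : Type*} (A : Set X) (f : X → V) :
    partialId A ≤ Setoid.ker (Sum.elim f f) := by
  rintro z w (rfl | ⟨a, -, rfl | rfl, rfl | rfl⟩) <;> rfl

/-- The partition `δ` cut down to `A` on the left and to `B` on the right. -/
def restrict (A B : Set X) (δ : PMon X) : PMon X := partialId A * δ * partialId B

lemma restrict_le (A B : Set X) (δ : PMon X) : restrict A B δ ≤ δ := by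
  intro z w h
  let q : X ⊕ X → Quotient δ := Quotient.mk δ
  have hδ : δ = Setoid.ker (Sum.elim (q ∘ .inl) (q ∘ .inr)) := by
    ext z w
    rw [Setoid.ker_def, Sum.elim_comp_inl_inr]
    exact Quotient.eq.symm
  have := mul_le_ker _ _ _ (mul_le_ker _ _ _ (partialId_le_ker A _) hδ.le)
    (partialId_le_ker B _) h
  rwa [hδ]

lemma restrict_inl_inr {A B : Set X} {δ : PMon X} {x y : X} :
    restrict A B δ (.inl x) (.inr y) ↔ x ∈ A ∧ y ∈ B ∧ δ (.inl x) (.inr y) := by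
  constructor
  · refine fun h => ⟨?_, ?_, restrict_le _ _ _ h⟩
    · by_contra hx
      refine Sum.inr_ne_inl (not_mul_of_isolated_left (partialId B)
        (not_mul_of_isolated_left (α := partialId A) δ ?_) _ h)
      intro z hz
      rw [partialId_rel] at hz
      grind
    · by_contra hy
      refine Sum.inl_ne_inr (not_mul_of_isolated_right (partialId A * δ)
        (β := partialId B) ?_ _ ((restrict A B δ).symm h))
      intro z hz
      rw [partialId_rel] at hz
      grind
  · rintro ⟨hx, hy, h⟩
    exact mul_inl_inr (mul_inl_inr (partialId_mem hx) h) (partialId_mem hy)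

lemma restrict_inl_inl {A : Set X} (B : Set X) {δ : PMon X} {x y : X} (hx : x ∈ A) (hy : y ∈ A)
    (h : δ (.inl x) (.inl y)) : restrict A B δ (.inl x) (.inl y) :=
  mul_inl_inl _ (mul_inl_inl_of_middle (partialId_mem hx) h
    ((partialId A).symm (partialId_mem hy)))

section Collapse

universe u
variable {X : Type u}

lemma rank_restrict_le (A B : Set X) (δ : PMon X) :
    rank (restrict A B δ) ≤ #{t : Transversal δ // ∃ a ∈ A, Sum.inl a ∈ t.1} := by
  refine rank_le_mk (fun z t => ∃ a ∈ A, z = Sum.inl a ∧ Sum.inl a ∈ t.1.1) ?_ ?_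
  · intro x y hxy
    obtain ⟨hx, -, h⟩ := restrict_inl_inr.1 hxy
    obtain ⟨t, ht, -⟩ := Transversal.exists_mem h
    exact ⟨.inl x, ⟨t, x, hx, ht⟩, (restrict A B δ).refl _, x, hx, rfl, ht⟩
  · rintro _ _ t ⟨a, ha, rfl, hat⟩ ⟨b, hb, rfl, hbt⟩
    exact restrict_inl_inl B ha hb (t.1.2.rel hat hbt)

/-- If `R` is a partial function from a set to a strictly smaller set `J` with more than one
element, some subset with at least `#J` elements has fewer than `#J` values. -/
lemma exists_subset_few_values {I J : Type u} (R : I → J → Prop)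
    (hR : ∀ i j k, R i j → R i k → j = k) (hIJ : #J < #I) (hJ : 1 < #J) :
    ∃ L : Set I, #J ≤ #L ∧ #{j : J // ∃ i ∈ L, R i j} < #J := by
  classical
  rcases lt_or_ge #J ℵ₀ with hfin | hinf
  · have : Finite J := Cardinal.mk_lt_aleph0_iff.1 hfin
    have := Fintype.ofFinite J
    obtain ⟨i, i', hi⟩ : ∃ i i', ∀ j, R i j → i' ≠ i ∧ R i' j := by
      by_contra! hcon
      refine hIJ.not_ge ?_
      choose f hf hf' using hcon
      have hinj : Function.Injective fun i => f i i := by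
        intro i k hik
        by_contra hne
        have h1 := hf i i
        have h2 := hf' i k (Ne.symm hne)
        have h3 := hR _ _ _ (hf i k) h1
        refine h2 ?_
        rw [h3]
        simp only at hik
        exact hik ▸ hf k k
      exact Cardinal.mk_le_of_injective hinj
    have hcard : ∃ L : Finset I, i ∈ L ∧ i' ∈ L ∧ L.card = Fintype.card J := by
      have h2 : 2 ≤ Fintype.card J := by
        rw [Cardinal.mk_fintype] at hJ
        exact_mod_cast hJ
      obtain ⟨S, hS⟩ : ∃ S : Finset I, S.card = Fintype.card J := by
        obtain ⟨S, hS⟩ := Cardinal.le_mk_iff_exists_set.1 hIJ.le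
        have : Finite S := Cardinal.mk_lt_aleph0_iff.1 (hS ▸ hfin)
        have := Fintype.ofFinite S
        refine ⟨S.toFinset, ?_⟩
        rw [Cardinal.mk_fintype, Cardinal.mk_fintype] at hS
        rw [Set.toFinset_card]
        exact_mod_cast hS
      obtain ⟨L, hL, -, hL'⟩ := Finset.exists_subsuperset_card_eq (s := {i, i'})
        (t := {i, i'} ∪ S) Finset.subset_union_left (Finset.card_le_two.trans h2)
        (hS ▸ Finset.card_le_card Finset.subset_union_right)
      exact ⟨L, hL (by simp), hL (by simp), hL'⟩
    obtain ⟨L, hi0, hi1, hL⟩ := hcard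
    refine ⟨L, by simp [hL], ?_⟩
    have hval (j : {j : J // ∃ i ∈ (L : Set I), R i j}) : ∃ k ∈ L.erase i, R k j := by
      obtain ⟨j, k, hk, hkj⟩ := j
      by_cases hki : k = i
      · subst hki
        exact ⟨i', Finset.mem_erase.2 ⟨(hi j hkj).1, hi1⟩, (hi j hkj).2⟩
      · exact ⟨k, Finset.mem_erase.2 ⟨hki, hk⟩, hkj⟩
    choose f hf hf' using hval
    have hle : #{j : J // ∃ i ∈ (L : Set I), R i j} ≤ #(L.erase i) :=
      Cardinal.mk_le_of_injective (f := fun j => (⟨f j, hf j⟩ : L.erase i)) fun j k hjk =>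
        Subtype.ext (hR (f j) _ _ (hf' j) (by
          have : f j = f k := congrArg Subtype.val hjk
          rw [this]; exact hf' k))
    refine hle.trans_lt ?_
    rw [Cardinal.mk_coe_finset, Cardinal.mk_fintype, ← hL]
    exact_mod_cast Finset.card_erase_lt_of_mem hi0
  · let f (i : I) : Option J := if h : ∃ j, R i j then some h.choose else none
    have hf {i j} (hij : R i j) : f i = some j := by
      have h : ∃ j, R i j := ⟨j, hij⟩
      simp only [f, dif_pos h, hR _ _ _ h.choose_spec hij]
    obtain ⟨o, ho⟩ := Cardinal.infinite_pigeonhole_card f (Order.succ #J)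
      (Order.succ_le_of_lt hIJ) (hinf.trans (Order.le_succ _)) (by
        rw [(Cardinal.isRegular_succ hinf).cof_ord, Cardinal.mk_option,
          Cardinal.add_one_eq hinf]
        exact Order.lt_succ _)
    refine ⟨f ⁻¹' {o}, (Order.le_succ _).trans ho, lt_of_le_of_lt ?_ hJ⟩
    rw [Cardinal.le_one_iff_subsingleton]
    refine ⟨fun ⟨j, i, hi, hij⟩ ⟨k, i', hi', hik⟩ => Subtype.ext (Option.some_injective _ ?_)⟩
    rw [← hf hij, ← hf hik, hi, hi']

/-- Restricting two partitions of distinct ranks to suitable subsets separates their ranks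
on either side of the smaller one. -/
lemma exists_restrict_rank_lt {α β : PMon X} (hrank : rank β < rank α) (hβ : rank β ≠ 0) :
    ∃ A B : Set X,
      rank β ≤ rank (restrict A B α) ∧ rank (restrict A B β) < rank β ∨
      rank β ≤ rank (restrict A B β) ∧ rank (restrict A B α) < rank β := by
  choose a ha using fun t : Transversal α => t.2.2.1
  choose b hb using fun t : Transversal α => t.2.2.2
  have hab t : α (.inl (a t)) (.inr (b t)) := t.2.rel (ha t) (hb t)
  have hα (L : Set (Transversal α)) : #L ≤ rank (restrict (a '' L) (b '' L) α) :=
    mk_le_rank (fun t => a t) (fun t => b t)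
      (fun t => restrict_inl_inr.2 ⟨⟨t, t.2, rfl⟩, ⟨t, t.2, rfl⟩, hab t⟩)
      (fun s t h => Subtype.ext
        (Transversal.eq_of_rel (ha s) (ha t) (restrict_le _ _ _ h)))
  rcases (Cardinal.one_le_iff_ne_zero.2 hβ).eq_or_lt with h1 | h1
  · by_cases hdiag : ∀ t, β (.inl (a t)) (.inr (b t))
    · obtain ⟨s, t, hst⟩ := Cardinal.one_lt_iff_nontrivial.1 (h1 ▸ hrank : 1 < rank α)
      have hsub := Cardinal.le_one_iff_subsingleton.1 (h1 ▸ le_rfl : rank β ≤ 1)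
      obtain ⟨s', hs, -⟩ := Transversal.exists_mem (hdiag s)
      obtain ⟨t', -, ht⟩ := Transversal.exists_mem (hdiag t)
      obtain rfl : s' = t' := hsub.elim _ _
      refine ⟨{a s}, {b t}, .inr ⟨?_, ?_⟩⟩
      · rw [← h1, Cardinal.one_le_iff_ne_zero, Ne, rank_eq_zero_iff]
        exact fun h => h _ _ (restrict_inl_inr.2 ⟨rfl, rfl, s'.2.rel hs ht⟩)
      · rw [← h1, Cardinal.lt_one_iff, rank_eq_zero_iff]
        intro x y hxy
        obtain ⟨rfl, rfl, h⟩ := restrict_inl_inr.1 hxy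
        exact hst (Transversal.eq_of_rel (ha s) (hb t) h)
    · obtain ⟨t, ht⟩ := not_forall.1 hdiag
      refine ⟨a '' {t}, b '' {t}, .inl ⟨?_, ?_⟩⟩
      · simpa [← h1] using hα {t}
      · rw [← h1, Cardinal.lt_one_iff, rank_eq_zero_iff]
        intro x y hxy
        rw [Set.image_singleton, Set.image_singleton] at hxy
        obtain ⟨rfl, rfl, h⟩ := restrict_inl_inr.1 hxy
        exact ht h
  · obtain ⟨L, hL, hL'⟩ := exists_subset_few_values
      (fun (s : Transversal α) (t : Transversal β) => Sum.inl (a s) ∈ t.1)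
      (fun s t t' h h' => Transversal.eq_of_rel h h' (β.refl _)) hrank h1
    refine ⟨a '' L, b '' L, .inl ⟨hL.trans (hα L), (rank_restrict_le _ _ _).trans_lt ?_⟩⟩
    simpa only [Set.exists_mem_image] using! hL'

lemma Con.restrict {c : Con (PMon X)} {α β : PMon X} (h : c α β) (A B : Set X) :
    c (restrict A B α) (restrict A B β) :=
  c.mul (c.mul (c.refl _) h) (c.refl _)

/-- A congruence relating partitions of distinct ranks relates the one of larger rank to a
partition of rank zero. -/
lemma exists_rank_zero_related (c : Con (PMon X)) {α β : PMon X} (hαβ : c α β)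
    (hrank : rank β < rank α) : ∃ ζ, c α ζ ∧ rank ζ = 0 := by
  induction h : rank β using WellFoundedLT.induction generalizing β with
  | ind q ih =>
  subst h
  by_cases h0 : rank β = 0
  · exact ⟨β, hαβ, h0⟩
  obtain ⟨δ, ε, hδε, hδ, hε⟩ :
      ∃ δ ε, c δ ε ∧ rank β ≤ rank δ ∧ rank ε < rank β := by
    obtain ⟨A, B, ⟨h1, h2⟩ | ⟨h1, h2⟩⟩ := exists_restrict_rank_lt hrank h0
    · exact ⟨_, _, Con.restrict hαβ A B, h1, h2⟩
    · exact ⟨_, _, Con.restrict (c.symm hαβ) A B, h1, h2⟩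
  obtain ⟨l, r, hlr⟩ := exists_eq_mul_mul hδ
  have hβ : c β (l * ε * r) := by
    nth_rewrite 1 [hlr]
    exact c.mul (c.mul (c.refl _) hδε) (c.refl _)
  have hlt := (rank_mul_mul_le l ε r).trans_lt hε
  exact ih _ hlt (c.trans hαβ hβ) (hlt.trans hrank) rfl

lemma mul_bot_mul (γ : PMon X) : γ * ⊥ * γ = hat γ := by
  apply le_antisymm
  · intro z w hzw
    let q : X ⊕ X → Quotient γ := Quotient.mk γ
    have hγ (b : Bool) : γ ≤ Setoid.ker (Sum.elim (fun x => (q (.inl x), b))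
        (fun x => (q (.inr x), b))) := by
      intro z w hzw
      have : q z = q w := Quotient.sound hzw
      rw [Setoid.ker_def]
      rcases z with z | z <;> rcases w with w | w <;> exact Prod.ext this rfl
    have := mul_le_ker _ _ _ (mul_le_ker _ _ _ (hγ true) bot_le) (hγ false) hzw
    rw [Setoid.ker_def] at this
    rcases z with z | z <;> rcases w with w | w <;>
      simp only [Sum.elim_inl, Sum.elim_inr, Prod.mk.injEq, reduceCtorEq, and_false, and_true]
        at this <;>
      exact ⟨Quotient.exact this, rfl⟩
  · rintro (z | z) (w | w) ⟨hz, hz'⟩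
    · exact mul_inl_inl _ (mul_inl_inl _ hz)
    · exact nomatch hz'
    · exact nomatch hz'
    · exact mul_inr_inr _ hz

end Collapse

/-- Lemma 5.8: if a congruence `σ` on `P_X` relates a pair `(α,β)` with
`rank α > rank β`, then `(γ, γ̂) ∈ σ` for every `γ` with `rank γ ≤ rank α`. -/
theorem hat_related_of_rank_collapse [Infinite X] (c : Con (PMon X))
    (α β : PMon X) (hαβ : c α β) (hrank : rank β < rank α) :
    ∀ γ : PMon X, rank γ ≤ rank α → c γ (hat γ) := by
  intro γ hγ
  obtain ⟨ζ, hζ, hζ0⟩ := exists_rank_zero_related c hαβ hrank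
  obtain ⟨l, r, hlr⟩ := exists_eq_mul_mul hγ
  have hγη : c γ (l * ζ * r) := by
    nth_rewrite 1 [hlr]
    exact c.mul (c.mul (c.refl _) hζ) (c.refl _)
  set η := l * ζ * r
  have hη : rank η = 0 := le_antisymm ((rank_mul_mul_le l ζ r).trans hζ0.le) zero_le
  have hhat : hat η = η := inf_eq_left.2 fun z w hzw => by
    rw [rank_eq_zero_iff] at hη
    rcases z with z | z <;> rcases w with w | w
    · rfl
    · exact absurd hzw (hη z w)
    · exact absurd (η.symm hzw) (hη w z)
    · rfl
  have h : c (γ * ⊥ * γ) (η * ⊥ * η) := c.mul (c.mul hγη (c.refl _)) hγη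
  rw [mul_bot_mul, mul_bot_mul, hhat] at h
  exact c.trans hγη (c.symm h)

end PartitionCongruences
end
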